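/- arXiv:1705.07001 — 2 statements merged into one kernel-verified Lean document; each statement's English description precedes it below -/
import Mathlib

section
/- There exists a constant c > 0 such that the following holds for all integers n ≥ 2 and k ≥ 1. Let v_1, …, v_k be real numbers, and let X_1, …, X_ℓ be ℓ independent samples drawn uniformly at random (with replacement) from the multiset {v_1, …, v_k}, where ℓ ≥ c·log n is odd. Let M be the median of X_1, …, X_ℓ. Then with probability at least 1 − 1/n², the number of indices i ∈ {1, …, k} with v_i ≤ M is at least k/3. -/
open MeasureTheory

/-- The median of the `ℓ` real numbers `x 0, …, x (ℓ−1)` (intended for odd `ℓ`):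
the `((ℓ+1)/2)`-th smallest among them, i.e. the entry at index `(ℓ+1)/2 − 1` of the
list sorted in nondecreasing order. -/
noncomputable def sampleMedian {ℓ : ℕ} (x : Fin ℓ → ℝ) : ℝ :=
  ((List.ofFn x).insertionSort (· ≤ ·)).getD ((ℓ + 1) / 2 - 1) 0

/-- At least `(ℓ + 1) / 2` of the entries of a nonempty sample are at most the sample median. -/
theorem half_le_card_le_sampleMedian {ℓ : ℕ} (hℓ : 0 < ℓ) (x : Fin ℓ → ℝ) :
    (ℓ + 1) / 2 ≤ (Finset.univ.filter (fun j => x j ≤ sampleMedian x)).card := by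
  set L := (List.ofFn x).insertionSort (· ≤ ·) with hL
  have hlen : L.length = ℓ := by simp [hL]
  have hsort : L.Pairwise (· ≤ ·) := List.pairwise_insertionSort _ _
  have hidx : (ℓ + 1) / 2 - 1 < L.length := by omega
  have hmed : sampleMedian x = L[(ℓ + 1) / 2 - 1] := by
    rw [sampleMedian, ← hL, List.getD_eq_getElem _ _ hidx]
  have hcount : L.countP (fun y => decide (y ≤ sampleMedian x)) =
      (Finset.univ.filter (fun j => x j ≤ sampleMedian x)).card := by
    rw [(List.perm_insertionSort (· ≤ ·) (List.ofFn x)).countP_eq, List.ofFn_eq_map,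
      List.countP_map, List.countP_eq_length_filter]
    rfl
  have htake : (L.take ((ℓ + 1) / 2)).countP (fun y => decide (y ≤ sampleMedian x)) =
      (L.take ((ℓ + 1) / 2)).length := by
    rw [List.countP_eq_length]
    intro y hy
    obtain ⟨i, hi, rfl⟩ := List.mem_iff_getElem.1 hy
    rw [List.length_take] at hi
    rw [List.getElem_take, decide_eq_true_iff, hmed]
    exact hsort.sortedLE.getElem_le_getElem_of_le (by omega)
  rw [← hcount]
  calc (ℓ + 1) / 2 = (L.take ((ℓ + 1) / 2)).length := by rw [List.length_take]; omega
    _ = _ := htake.symm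
    _ ≤ _ := (List.take_sublist _ _).countP_le

/-- Markov's inequality for `2 ^ #{j | ω j ∈ B}`, with `ω` uniform: few tuples have at least
`r` entries in `B`. -/
theorem card_many_hits_mul_two_pow_le {α : Type*} [Fintype α] [DecidableEq α]
    (B : Finset α) (ℓ r : ℕ) :
    (Finset.univ.filter (fun ω : Fin ℓ → α =>
        r ≤ (Finset.univ.filter (fun j => ω j ∈ B)).card)).card * 2 ^ r ≤
      (Fintype.card α + B.card) ^ ℓ := by
  have hsum : ∑ a : α, (if a ∈ B then 2 else 1) = Fintype.card α + B.card := by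
    have h (a : α) : (if a ∈ B then 2 else 1) = 1 + if a ∈ B then 1 else 0 := by
      split_ifs <;> rfl
    simp [h, Finset.sum_add_distrib]
  rw [← hsum, Fintype.sum_pow, ← smul_eq_mul]
  refine (Finset.card_nsmul_le_sum _ (fun ω => ∏ j, if ω j ∈ B then 2 else 1) _ ?_).trans
    (Finset.sum_le_sum_of_subset (Finset.filter_subset _ _))
  intro ω hω
  rw [Finset.prod_ite]
  simpa using Nat.pow_le_pow_right two_pos (Finset.mem_filter.1 hω).2

/-- If `B` holds at most a third of a finite type, the tuples having at least half
of their entries in `B` form an exponentially small fraction of all tuples. -/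
theorem sq_card_majority_hits_mul_nine_pow_le {α : Type*} [Fintype α] [DecidableEq α]
    (B : Finset α) (hB : 3 * B.card ≤ Fintype.card α) (ℓ : ℕ) :
    (Finset.univ.filter (fun ω : Fin ℓ → α =>
        (ℓ + 1) / 2 ≤ (Finset.univ.filter (fun j => ω j ∈ B)).card)).card ^ 2 * 9 ^ ℓ ≤
      8 ^ ℓ * (Fintype.card α ^ ℓ) ^ 2 := by
  have h := card_many_hits_mul_two_pow_le B ℓ ((ℓ + 1) / 2)
  set N := (Finset.univ.filter (fun ω : Fin ℓ → α =>
    (ℓ + 1) / 2 ≤ (Finset.univ.filter (fun j => ω j ∈ B)).card)).card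
  set k := Fintype.card α
  refine Nat.le_of_mul_le_mul_right ?_ (pow_pos (two_pos : 0 < 2) ℓ)
  calc N ^ 2 * 9 ^ ℓ * 2 ^ ℓ ≤ N ^ 2 * 9 ^ ℓ * 2 ^ ((ℓ + 1) / 2 * 2) := by
        gcongr
        · norm_num
        · omega
    _ = (N * 2 ^ ((ℓ + 1) / 2)) ^ 2 * 9 ^ ℓ := by ring
    _ ≤ ((k + B.card) ^ ℓ) ^ 2 * 9 ^ ℓ := by gcongr
    _ = ((3 * (k + B.card)) ^ ℓ) ^ 2 := by
        rw [mul_pow, mul_pow, ← pow_mul 3, mul_comm ℓ 2, pow_mul 3]; ring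
    _ ≤ ((4 * k) ^ ℓ) ^ 2 := by
        have : 3 * (k + B.card) ≤ 4 * k := by omega
        exact Nat.pow_le_pow_left (Nat.pow_le_pow_left this ℓ) 2
    _ = 8 ^ ℓ * (k ^ ℓ) ^ 2 * 2 ^ ℓ := by
        rw [mul_pow, mul_pow, ← pow_mul 4, mul_comm ℓ 2, pow_mul 4,
          show (4 : ℕ) ^ 2 = 8 * 2 by rfl, mul_pow 8 2]
        ring

/-- The entries of a finite family whose rank is below a third of the size of the family make up
at most a third of it. -/
theorem three_mul_card_low_rank_le {α : Type*} [Fintype α] (v : α → ℝ) :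
    3 * (Finset.univ.filter (fun i =>
        3 * (Finset.univ.filter (fun j => v j ≤ v i)).card < Fintype.card α)).card ≤
      Fintype.card α := by
  set B := Finset.univ.filter (fun i =>
    3 * (Finset.univ.filter (fun j => v j ≤ v i)).card < Fintype.card α) with hB
  rcases B.eq_empty_or_nonempty with h | h
  · simp [h]
  · obtain ⟨b, hb, hmax⟩ := B.exists_max_image v h
    have hsub : B ⊆ Finset.univ.filter (fun j => v j ≤ v b) := fun j hj => by
      simpa using hmax j hj
    have hlt := (Finset.mem_filter.1 hb).2
    have := Finset.card_le_card hsub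
    omega

/-- A logarithmic lower bound on the exponent makes `(9 / 8) ^ ℓ` polynomially large. -/
theorem pow_four_mul_eight_pow_le {n ℓ : ℕ} (hn : 0 < n) (h : 36 * Real.log n ≤ ℓ) :
    n ^ 4 * 8 ^ ℓ ≤ 9 ^ ℓ := by
  have hn' : (0 : ℝ) < n := by exact_mod_cast hn
  have hlog : 1 / 9 ≤ Real.log (9 / 8) := by
    have := Real.one_sub_inv_le_log_of_pos (show (0 : ℝ) < 9 / 8 by norm_num)
    norm_num at this ⊢
    exact this
  have hpow : (n : ℝ) ^ 4 ≤ (9 / 8) ^ ℓ := by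
    rw [← Real.log_le_log_iff (by positivity) (by positivity), Real.log_pow, Real.log_pow]
    push_cast
    nlinarith [(Nat.cast_nonneg ℓ : (0 : ℝ) ≤ ℓ)]
  rw [div_pow, le_div_iff₀ (by positivity)] at hpow
  exact_mod_cast hpow

/-- Chernoff-bound kernel for the runtime guarantee of SMED.
There is a constant `c > 0` such that for all integers `n ≥ 2` and `k ≥ 1`, all reals
`v_1, …, v_k`, and all odd `ℓ ≥ c·log n`: if `X_1, …, X_ℓ` are independent uniform
samples (with replacement) from the multiset `{v_1, …, v_k}` and `M` is their median,
then with probability at least `1 − 1/n²` the number of indices `i` with `v_i ≤ M`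
is at least `k/3`. -/
theorem smed_sample_median_lower_quantile :
    ∃ c : ℝ, 0 < c ∧
      ∀ (n k : ℕ), 2 ≤ n → ∀ (hk : 1 ≤ k), ∀ (v : Fin k → ℝ) (ℓ : ℕ), Odd ℓ →
        c * Real.log n ≤ (ℓ : ℝ) →
        (@PMF.uniformOfFintype (Fin ℓ → Fin k) _ ⟨fun _ => ⟨0, hk⟩⟩).toMeasure
            {ω : Fin ℓ → Fin k |
              (k : ℝ) / 3 ≤
                ((Finset.univ.filter
                  (fun i : Fin k => v i ≤ sampleMedian (fun j => v (ω j)))).card : ℝ)} ≥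
          1 - 1 / (n : ENNReal) ^ 2 := by
  refine ⟨36, by norm_num, fun n k hn hk v ℓ hodd hℓ => ?_⟩
  set G : Set (Fin ℓ → Fin k) := {ω | (k : ℝ) / 3 ≤
    ((Finset.univ.filter
      (fun i : Fin k => v i ≤ sampleMedian (fun j => v (ω j)))).card : ℝ)} with hG
  set B : Finset (Fin k) := Finset.univ.filter (fun i =>
    3 * (Finset.univ.filter (fun j => v j ≤ v i)).card < Fintype.card (Fin k)) with hB
  set N := Finset.univ.filter (fun ω : Fin ℓ → Fin k =>
    (ℓ + 1) / 2 ≤ (Finset.univ.filter (fun j => ω j ∈ B)).card) with hN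
  have hNcard : N.card * n ^ 2 ≤ k ^ ℓ := by
    have h1 := sq_card_majority_hits_mul_nine_pow_le B (three_mul_card_low_rank_le v) ℓ
    rw [Fintype.card_fin, ← hN] at h1
    have h2 := pow_four_mul_eight_pow_le (by omega) hℓ
    rw [← Nat.pow_le_pow_iff_left two_ne_zero]
    refine Nat.le_of_mul_le_mul_right ?_ (pow_pos (by norm_num : 0 < 8) ℓ)
    calc (N.card * n ^ 2) ^ 2 * 8 ^ ℓ = N.card ^ 2 * (n ^ 4 * 8 ^ ℓ) := by ring
      _ ≤ N.card ^ 2 * 9 ^ ℓ := by gcongr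
      _ ≤ (k ^ ℓ) ^ 2 * 8 ^ ℓ := by rw [mul_comm _ (8 ^ ℓ)]; exact h1
  have hbad : ∀ ω, ω ∉ G → ω ∈ N := by
    intro ω hω
    rw [hG, Set.mem_ofPred_eq, not_le, lt_div_iff₀ (by norm_num)] at hω
    have hω' : (Finset.univ.filter
        (fun i : Fin k => v i ≤ sampleMedian (fun j => v (ω j)))).card * 3 < k := by
      exact_mod_cast hω
    refine Finset.mem_filter.2 ⟨Finset.mem_univ _,
      (half_le_card_le_sampleMedian hodd.pos (fun j => v (ω j))).trans
        (Finset.card_le_card fun j hj => ?_)⟩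
    simp only [Finset.mem_filter, Finset.mem_univ, true_and] at hj
    simp only [hB, Finset.mem_filter, Finset.mem_univ, true_and, Fintype.card_fin]
    have := Finset.card_le_card (Finset.monotone_filter_right (Finset.univ : Finset (Fin k))
      (fun i _ (hi : v i ≤ v (ω j)) => hi.trans hj))
    omega
  classical
  have : Nonempty (Fin ℓ → Fin k) := ⟨fun _ => ⟨0, hk⟩⟩
  have hcover : k ^ ℓ ≤ Fintype.card G + N.card := by
    calc k ^ ℓ = (Finset.univ : Finset (Fin ℓ → Fin k)).card := by simp
      _ ≤ (G.toFinset ∪ N).card := Finset.card_le_card fun ω _ => by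
          by_cases h : ω ∈ G
          · simp [h]
          · simp [hbad ω h]
      _ ≤ _ := (Finset.card_union_le _ _).trans (by rw [Set.toFinset_card])
  have hk0 : ((k ^ ℓ : ℕ) : ENNReal) ≠ 0 := by
    exact_mod_cast (pow_pos hk ℓ).ne'
  rw [PMF.toMeasure_uniformOfFintype_apply G (Set.toFinite G).measurableSet, ge_iff_le,
    tsub_le_iff_right, Fintype.card_fun, Fintype.card_fin, Fintype.card_fin]
  calc (1 : ENNReal) = ((k ^ ℓ : ℕ) : ENNReal) / ((k ^ ℓ : ℕ) : ENNReal) :=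
        (ENNReal.div_self hk0 (ENNReal.natCast_ne_top _)).symm
    _ ≤ ((Fintype.card G + N.card : ℕ) : ENNReal) / ((k ^ ℓ : ℕ) : ENNReal) := by gcongr
    _ = (Fintype.card G : ENNReal) / ((k ^ ℓ : ℕ) : ENNReal)
        + (N.card : ENNReal) / ((k ^ ℓ : ℕ) : ENNReal) := by
        rw [Nat.cast_add, ENNReal.add_div]
    _ ≤ (Fintype.card G : ENNReal) / ((k ^ ℓ : ℕ) : ENNReal) + 1 / (n : ENNReal) ^ 2 := by
        refine add_le_add le_rfl ?_
        have hn0 : (n : ENNReal) ^ 2 ≠ 0 := by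
          exact_mod_cast (pow_pos (by omega : 0 < n) 2).ne'
        rw [ENNReal.le_div_iff_mul_le (Or.inl hn0) (Or.inr ENNReal.one_ne_top), mul_comm,
          ← mul_div_assoc]
        refine ENNReal.div_le_of_le_mul ?_
        rw [one_mul, mul_comm]
        exact_mod_cast hNcard
end

section
/- For every constant c > 2 there exists a constant c' > 0 such that the following holds for all integers n ≥ 2 and k ≥ 1. Let v_1, …, v_k be real numbers, and let X_1, …, X_ℓ be ℓ independent samples drawn uniformly at random (with replacement) from the multiset {v_1, …, v_k}, where ℓ ≥ c'·log n is odd. Let M be the median of X_1, …, X_ℓ. Then with probability at least 1 − 1/n², the number of indices i ∈ {1, …, k} with v_i ≥ M is at least k/c. -/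
open MeasureTheory

/-- At least half of the sample lies weakly above its median. -/
lemma le_two_mul_card_sampleMedian_le {ℓ : ℕ} (x : Fin ℓ → ℝ) :
    ℓ ≤ 2 * (Finset.univ.filter (fun j => sampleMedian x ≤ x j)).card := by
  rcases Nat.eq_zero_or_pos ℓ with rfl | hℓ
  · simp
  set L := (List.ofFn x).insertionSort (· ≤ ·) with hL
  have hlen : L.length = ℓ := by simp [hL]
  have hm : (ℓ + 1) / 2 - 1 < L.length := by omega
  have hM : sampleMedian x = L[(ℓ + 1) / 2 - 1] := by
    simp only [sampleMedian, ← hL]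
    exact List.getD_eq_getElem _ _ hm
  have hsorted : L.Pairwise (· ≤ ·) := List.pairwise_insertionSort _ _
  have hdrop : (L.drop ((ℓ + 1) / 2 - 1)).countP (fun y => decide (sampleMedian x ≤ y))
      = (L.drop ((ℓ + 1) / 2 - 1)).length := by
    rw [List.countP_eq_length]
    intro y hy
    obtain ⟨i, hi, rfl⟩ := List.mem_iff_getElem.1 hy
    rw [List.getElem_drop, hM, decide_eq_true_eq]
    exact hsorted.sortedLE.getElem_le_getElem_of_le (Nat.le_add_right _ _)
  have hsub := (List.drop_sublist ((ℓ + 1) / 2 - 1) L).countP_le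
    (p := fun y => decide (sampleMedian x ≤ y))
  rw [hdrop, List.length_drop, hlen, (List.perm_insertionSort _ _).countP_eq] at hsub
  have hcount : (List.ofFn x).countP (fun y => decide (sampleMedian x ≤ y))
      = (Finset.univ.filter (fun j => sampleMedian x ≤ x j)).card := by
    rw [List.ofFn_eq_map, List.countP_map, List.countP_eq_length_filter,
      ← List.toFinset_card_of_nodup ((List.nodup_finRange ℓ).filter _)]
    congr 1
    ext j
    simp
  omega

/-- The indices whose value has upper rank below `r` number at most `r`. -/
lemma card_upperRank_lt_le {ι : Type*} [Fintype ι] (v : ι → ℝ) {r : ℝ} (hr : 0 ≤ r) :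
    ((Finset.univ.filter fun i =>
      ((Finset.univ.filter fun j => v i ≤ v j).card : ℝ) < r).card : ℝ) ≤ r := by
  set B := Finset.univ.filter fun i =>
      ((Finset.univ.filter fun j => v i ≤ v j).card : ℝ) < r with hB
  rcases B.eq_empty_or_nonempty with h | h
  · simpa [h] using hr
  obtain ⟨i, hi, hmin⟩ := B.exists_min_image v h
  have hi' := (Finset.mem_filter.1 hi).2
  refine le_trans ?_ hi'.le
  exact_mod_cast Finset.card_le_card fun j hj => by simpa using hmin j hj

/-- Exponential-moment bound for the number of tuples with at least half of their entries
in `B`. -/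
lemma card_half_entries_mem_le {ι : Type*} [Fintype ι] [DecidableEq ι] (B : Finset ι) (ℓ : ℕ)
    {a : ℝ} (ha : 1 ≤ a) :
    ((Finset.univ.filter fun ω : Fin ℓ → ι =>
        ℓ ≤ 2 * (Finset.univ.filter fun j => ω j ∈ B).card).card : ℝ) ≤
      (B.card * a + (Fintype.card ι - B.card) * a⁻¹) ^ ℓ := by
  have ha0 : 0 < a := by linarith
  have hsum : ∑ i : ι, (if i ∈ B then a else a⁻¹)
      = B.card * a + (Fintype.card ι - B.card) * a⁻¹ := by
    rw [Finset.sum_ite, Finset.sum_const, Finset.sum_const, Finset.filter_not,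
      Finset.filter_univ_mem, ← Finset.compl_eq_univ_sdiff, Finset.card_compl,
      nsmul_eq_mul, nsmul_eq_mul, Nat.cast_sub (Finset.card_le_univ B)]
  rw [← hsum, Fintype.sum_pow, Finset.card_filter, Nat.cast_sum]
  refine Finset.sum_le_sum fun ω _ => ?_
  split_ifs with h
  · rw [Finset.prod_ite, Finset.prod_const, Finset.prod_const, Nat.cast_one]
    have hadd := Finset.card_filter_add_card_filter_not (s := Finset.univ)
      (fun j => ω j ∈ B)
    rw [Finset.card_univ, Fintype.card_fin] at hadd
    rw [inv_pow, ← div_eq_mul_inv, one_le_div (by positivity)]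
    exact pow_le_pow_right₀ ha (by omega)
  · rw [Nat.cast_zero]
    exact Finset.prod_nonneg fun j _ => by split_ifs <;> positivity

/-- If at most a `1 / c` fraction of the values lies in `B`, then at least half of the entries
of a tuple lie in `B` for at most an exponentially small fraction of the tuples. -/
lemma card_half_entries_mem_le_mul_pow {c : ℝ} (hc : 2 < c) {k : ℕ} (B : Finset (Fin k))
    (hB : (B.card : ℝ) ≤ k / c) (ℓ : ℕ) :
    ((Finset.univ.filter fun ω : Fin ℓ → Fin k =>
        ℓ ≤ 2 * (Finset.univ.filter fun j => ω j ∈ B).card).card : ℝ) ≤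
      (k : ℝ) ^ ℓ * (1 / 2 + 2 * (c - 1) / c ^ 2) ^ ℓ := by
  have hc0 : 0 < c := by linarith
  have ha : 1 ≤ c / 2 := by linarith
  refine (card_half_entries_mem_le B ℓ ha).trans ?_
  rw [← mul_pow, Fintype.card_fin]
  have hBk : (B.card : ℝ) ≤ k := by exact_mod_cast (Finset.card_le_univ B).trans_eq (by simp)
  refine pow_le_pow_left₀ ?_ ?_ ℓ
  · have := sub_nonneg.2 hBk
    positivity
  · have hinv : (c / 2)⁻¹ ≤ c / 2 := (inv_le_one_of_one_le₀ ha).trans ha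
    calc (B.card : ℝ) * (c / 2) + (k - B.card) * (c / 2)⁻¹
        = B.card * (c / 2 - (c / 2)⁻¹) + k * (c / 2)⁻¹ := by ring
      _ ≤ k / c * (c / 2 - (c / 2)⁻¹) + k * (c / 2)⁻¹ := by
        gcongr
      _ = k * (1 / 2 + 2 * (c - 1) / c ^ 2) := by
        field_simp
        ring

/-- If fewer than `r` values lie weakly above the sample median, then at least half of the
sample has upper rank below `r`. -/
lemma le_two_mul_card_upperRank_lt {ι : Type*} [Fintype ι] [DecidableEq ι] (v : ι → ℝ) {r : ℝ}
    {ℓ : ℕ} (ω : Fin ℓ → ι)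
    (h : ((Finset.univ.filter fun i => v i ≥ sampleMedian fun j => v (ω j)).card : ℝ) < r) :
    ℓ ≤ 2 * (Finset.univ.filter fun j => ω j ∈ Finset.univ.filter fun i =>
      ((Finset.univ.filter fun m => v i ≤ v m).card : ℝ) < r).card := by
  refine (le_two_mul_card_sampleMedian_le fun j => v (ω j)).trans ?_
  gcongr with j _
  intro hj
  rw [Finset.mem_filter]
  refine ⟨Finset.mem_univ _, lt_of_le_of_lt ?_ h⟩
  exact_mod_cast Finset.card_le_card fun i hi => by
    simp only [Finset.mem_filter, Finset.mem_univ, true_and] at hi ⊢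
    exact hj.trans hi

lemma pow_le_one_div_sq {ρ : ℝ} (h0 : 0 < ρ) (h1 : ρ < 1) {n ℓ : ℕ} (hn : 0 < n)
    (h : 2 / -Real.log ρ * Real.log n ≤ ℓ) : ρ ^ ℓ ≤ 1 / (n : ℝ) ^ 2 := by
  have hlog : 0 < -Real.log ρ := neg_pos.2 (Real.log_neg h0 h1)
  have hn' : (0 : ℝ) < n := by exact_mod_cast hn
  rw [div_mul_eq_mul_div, div_le_iff₀ hlog] at h
  rw [← Real.log_le_log_iff (by positivity) (by positivity), Real.log_pow, one_div, Real.log_inv,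
    Real.log_pow]
  push_cast
  linarith

/-- Chernoff-bound kernel for the error guarantee of SMED.
For every constant `c > 2` there is a constant `c' > 0` such that for all integers
`n ≥ 2` and `k ≥ 1`, all reals `v_1, …, v_k`, and all odd `ℓ ≥ c'·log n`: if
`X_1, …, X_ℓ` are independent uniform samples (with replacement) from the multiset
`{v_1, …, v_k}` and `M` is their median, then with probability at least `1 − 1/n²`
the number of indices `i` with `v_i ≥ M` is at least `k/c`. -/
theorem smed_sample_median_upper_quantile :
    ∀ c : ℝ, 2 < c →
      ∃ c' : ℝ, 0 < c' ∧
        ∀ (n k : ℕ), 2 ≤ n → ∀ (hk : 1 ≤ k), ∀ (v : Fin k → ℝ) (ℓ : ℕ), Odd ℓ →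
          c' * Real.log n ≤ (ℓ : ℝ) →
          (@PMF.uniformOfFintype (Fin ℓ → Fin k) _ ⟨fun _ => ⟨0, hk⟩⟩).toMeasure
              {ω : Fin ℓ → Fin k |
                (k : ℝ) / c ≤
                  ((Finset.univ.filter
                    (fun i : Fin k => v i ≥ sampleMedian (fun j => v (ω j)))).card : ℝ)} ≥
            1 - 1 / (n : ENNReal) ^ 2 := by
  intro c hc
  have hc0 : 0 < c := by linarith
  set ρ : ℝ := 1 / 2 + 2 * (c - 1) / c ^ 2 with hρ
  have hρ0 : 0 < ρ := by
    have : 0 < c - 1 := by linarith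
    positivity
  have hρ1 : ρ < 1 := by
    have : 2 * (c - 1) / c ^ 2 < 1 / 2 := by
      rw [div_lt_iff₀ (by positivity)]
      nlinarith [sq_pos_of_pos (sub_pos.2 hc)]
    linarith
  refine ⟨2 / -Real.log ρ, div_pos two_pos (neg_pos.2 (Real.log_neg hρ0 hρ1)), ?_⟩
  intro n k hn hk v ℓ _ hℓ
  have : Nonempty (Fin ℓ → Fin k) := ⟨fun _ => ⟨0, hk⟩⟩
  set G := {ω : Fin ℓ → Fin k |
    (k : ℝ) / c ≤
      ((Finset.univ.filter
        (fun i : Fin k => v i ≥ sampleMedian (fun j => v (ω j)))).card : ℝ)} with hG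
  set B : Finset (Fin k) := Finset.univ.filter fun i =>
    ((Finset.univ.filter fun m => v i ≤ v m).card : ℝ) < k / c with hB
  set F : Finset (Fin ℓ → Fin k) := Finset.univ.filter fun ω =>
    ℓ ≤ 2 * (Finset.univ.filter fun j => ω j ∈ B).card with hF
  have hsub : Gᶜ ⊆ (F : Set (Fin ℓ → Fin k)) := fun ω hω => by
    rw [hF, Finset.mem_coe, Finset.mem_filter]
    exact ⟨Finset.mem_univ _, le_two_mul_card_upperRank_lt v ω (not_le.1 hω)⟩
  have hcard : (F.card : ℝ) ≤ (k : ℝ) ^ ℓ * (1 / (n : ℝ) ^ 2) :=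
    (card_half_entries_mem_le_mul_pow hc B (card_upperRank_lt_le v (by positivity)) ℓ).trans
      (by gcongr; exact pow_le_one_div_sq hρ0 hρ1 (by omega) hℓ)
  have hFμ : (PMF.uniformOfFintype (Fin ℓ → Fin k)).toMeasure (F : Set (Fin ℓ → Fin k))
      ≤ 1 / (n : ENNReal) ^ 2 := by
    rw [PMF.toMeasure_uniformOfFintype_apply _ F.measurableSet, ← Set.toFinset_card, Finset.toFinset_coe,
      Fintype.card_fun, Fintype.card_fin, Fintype.card_fin]
    have hn0 : (0 : ℝ) < (n : ℝ) ^ 2 := by positivity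
    rw [mul_one_div, le_div_iff₀ hn0] at hcard
    have hnat : F.card * n ^ 2 ≤ k ^ ℓ := by exact_mod_cast hcard
    rw [ENNReal.div_le_iff (by positivity) (by finiteness), mul_comm, mul_one_div,
      ENNReal.le_div_iff_mul_le (by left; positivity) (by left; finiteness)]
    exact_mod_cast hnat
  rw [ge_iff_le, tsub_le_iff_left]
  calc (1 : ENNReal) = (PMF.uniformOfFintype (Fin ℓ → Fin k)).toMeasure Gᶜ
        + (PMF.uniformOfFintype (Fin ℓ → Fin k)).toMeasure G := by
        rw [add_comm, measure_add_measure_compl (Set.toFinite G).measurableSet, measure_univ]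
    _ ≤ _ := by gcongr; exact (measure_mono hsub).trans hFμ
end
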